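/- Let k be a field and let U_∞(k) be the quotient of the free associative k-algebra on two generators x₁, x₂ by the two-sided ideal generated by x₁x₂ − x₂x₁ − x₁². Then there exists no k-linear anti-homomorphism σ : U_∞(k) → U_∞(k) (i.e. an additive, k-linear map with σ(1) = 1 and σ(ab) = σ(b)σ(a) for all a, b) satisfying σ(x̄₁) = x̄₂ and σ(x̄₂) = x̄₁. -/

import Mathlib

/-- The defining relation of `U_∞(k)`: we quotient the free associative algebra on
two generators `x₁ = ι 0`, `x₂ = ι 1` by the two-sided ideal generated by
`x₁x₂ − x₂x₁ − x₁²`, i.e. by the ring congruence identifying that element with `0`. -/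
def UinfRel (k : Type*) [Field k] :
    FreeAlgebra k (Fin 2) → FreeAlgebra k (Fin 2) → Prop := fun a b =>
  a = FreeAlgebra.ι k 0 * FreeAlgebra.ι k 1 - FreeAlgebra.ι k 1 * FreeAlgebra.ι k 0 -
      (FreeAlgebra.ι k 0) ^ 2 ∧ b = 0

/-- The character of `U_∞(k)` sending `x̄₁` to `0` and `x̄₂` to `1`. -/
noncomputable def uinfCharacter (k : Type*) [Field k] : RingQuot (UinfRel k) →+* k :=
  RingQuot.lift ⟨(FreeAlgebra.lift k (![0, 1] : Fin 2 → k)).toRingHom, by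
    rintro a b ⟨rfl, rfl⟩
    simp⟩

theorem uinfCharacter_mkRingHom_ι (k : Type*) [Field k] (i : Fin 2) :
    uinfCharacter k (RingQuot.mkRingHom (UinfRel k) (FreeAlgebra.ι k i)) =
      (![0, 1] : Fin 2 → k) i := by
  simp [uinfCharacter]

theorem uinf_mul_eq (k : Type*) [Field k] :
    RingQuot.mkRingHom (UinfRel k) (FreeAlgebra.ι k 0) *
        RingQuot.mkRingHom (UinfRel k) (FreeAlgebra.ι k 1) =
      RingQuot.mkRingHom (UinfRel k) (FreeAlgebra.ι k 1) *
          RingQuot.mkRingHom (UinfRel k) (FreeAlgebra.ι k 0) +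
        RingQuot.mkRingHom (UinfRel k) (FreeAlgebra.ι k 0) *
          RingQuot.mkRingHom (UinfRel k) (FreeAlgebra.ι k 0) := by
  have h := RingQuot.mkRingHom_rel (r := UinfRel k) ⟨rfl, rfl⟩
  rw [map_sub, map_sub, map_mul, map_mul, map_pow, map_zero, pow_two, sub_sub] at h
  exact sub_eq_zero.mp h

/-- there is no `k`-linear anti-homomorphism `σ` of `U_∞(k)`
swapping the images `x̄₁` and `x̄₂` of the two generators. -/
theorem stmt3 (k : Type*) [Field k] :
    ¬ ∃ σ : RingQuot (UinfRel k) → RingQuot (UinfRel k),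
      (∀ a b : RingQuot (UinfRel k), σ (a + b) = σ a + σ b) ∧
      (∀ (c : k) (a : RingQuot (UinfRel k)), σ (c • a) = c • σ a) ∧
      σ 1 = 1 ∧
      (∀ a b : RingQuot (UinfRel k), σ (a * b) = σ b * σ a) ∧
      σ (RingQuot.mkRingHom (UinfRel k) (FreeAlgebra.ι k 0)) =
        RingQuot.mkRingHom (UinfRel k) (FreeAlgebra.ι k 1) ∧
      σ (RingQuot.mkRingHom (UinfRel k) (FreeAlgebra.ι k 1)) =
        RingQuot.mkRingHom (UinfRel k) (FreeAlgebra.ι k 0) := by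
  rintro ⟨σ, hadd, -, -, hmul, h₀, h₁⟩
  have h := congrArg σ (uinf_mul_eq k)
  rw [hadd, hmul, hmul, hmul, h₀, h₁] at h
  simpa [uinfCharacter_mkRingHom_ι] using congrArg (uinfCharacter k) h
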